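/- For each N ∈ ℕ, let x(N) be an ℝ^N-valued random variable and O(N) a Haar-distributed N×N orthogonal random matrix independent of x(N), with √((1/N)∑_{n=1}^N x(N)_n²) → r > 0 almost surely as N → ∞; set h(N) = O(N)x(N). Let g : ℝ → ℝ be a measurable function, let N_g = {x ∈ ℝ : g is discontinuous at x}, and let Z ∼ N(0, r²). Assume P(Z ∈ N_g) = 0. Then the empirical distribution ν_{g(h(N))} = (1/N)∑_{n=1}^N δ_{g(h(N)_n)} converges weakly to the distribution of g(Z) almost surely as N → ∞. -/

import Mathlib

open MeasureTheory ProbabilityTheory Filter Topology Matrix BoundedContinuousFunction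
open scoped ENNReal NNReal

/-- Matrices inherit the product measurable structure on their entries. -/
instance {m n α : Type*} [MeasurableSpace α] : MeasurableSpace (Matrix m n α) :=
  inferInstanceAs (MeasurableSpace (m → n → α))

/-- The empirical distribution `(1/N) ∑ₙ δ_{v n}` of the entries of a vector `v ∈ ℝ^N`. -/
noncomputable def empDist {N : ℕ} (v : Fin N → ℝ) : Measure ℝ :=
  ((N : ℝ≥0∞))⁻¹ • ∑ n : Fin N, Measure.dirac (v n)

/-- `V` is a Haar-distributed `N × N` orthogonal random matrix: it is measurable, takes values
in the orthogonal group `O(N)`, and its law is invariant under left and right translation by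
every fixed orthogonal matrix.  On the compact group `O(N)` this characterizes the unique
Haar probability measure. -/
def IsHaarOrthogonal {N : ℕ} {Ω : Type*} [MeasurableSpace Ω] (μ : Measure Ω)
    (V : Ω → Matrix (Fin N) (Fin N) ℝ) : Prop :=
  Measurable V ∧ (∀ ω, V ω ∈ Matrix.orthogonalGroup (Fin N) ℝ) ∧
    (∀ U ∈ Matrix.orthogonalGroup (Fin N) ℝ,
      Measure.map (fun ω => U * V ω) μ = Measure.map V μ) ∧
    (∀ U ∈ Matrix.orthogonalGroup (Fin N) ℝ,
      Measure.map (fun ω => V ω * U) μ = Measure.map V μ)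

lemma ortho_transitive {N : ℕ} (x y : Fin N → ℝ) (hxy : ∑ n, x n ^ 2 = ∑ n, y n ^ 2) :
    ∃ U ∈ Matrix.orthogonalGroup (Fin N) ℝ, U.mulVec x = y := by
  let a : EuclideanSpace ℝ (Fin N) := WithLp.toLp 2 x
  let b : EuclideanSpace ℝ (Fin N) := WithLp.toLp 2 y
  have hab : ‖a‖ = ‖b‖ := by
    rw [EuclideanSpace.norm_eq, EuclideanSpace.norm_eq]
    simp [a, b, hxy]
  let ρ := (ℝ ∙ (a - b))ᗮ.reflection
  have hρ : ρ a = b := Submodule.reflection_sub hab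
  let B := EuclideanSpace.basisFun (Fin N) ℝ
  let U : Matrix (Fin N) (Fin N) ℝ := LinearMap.toMatrix B.toBasis B.toBasis ρ.toLinearEquiv.toLinearMap
  refine ⟨U, ?_, ?_⟩
  · exact LinearIsometryEquiv.toMatrix_mem_unitaryGroup ρ B B
  · have := LinearMap.toMatrix_mulVec_repr B.toBasis B.toBasis ρ.toLinearEquiv.toLinearMap a
    have hx : ⇑(B.toBasis.repr a) = x := by ext i; simp [B, a]
    have hy : ⇑(B.toBasis.repr b) = y := by ext i; simp [B, b]
    have h3 : ρ.toLinearEquiv.toLinearMap a = b := hρ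
    rw [hx, h3, hy] at this
    exact this

lemma ortho_norm {N : ℕ} (U : Matrix (Fin N) (Fin N) ℝ) (hU : U ∈ Matrix.orthogonalGroup (Fin N) ℝ)
    (x : Fin N → ℝ) : ∑ n, (U.mulVec x n) ^ 2 = ∑ n, x n ^ 2 := by
  have h1 : Uᵀ * U = 1 := by
    have := (Matrix.mem_orthogonalGroup_iff' _ _).1 hU
    simpa using this
  have h : (U.mulVec x) ⬝ᵥ (U.mulVec x) = x ⬝ᵥ x := by
    rw [Matrix.dotProduct_mulVec, ← Matrix.mulVec_transpose, Matrix.mulVec_mulVec, h1, Matrix.one_mulVec]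
  simpa [dotProduct, sq] using h

lemma gauss_rot {N : ℕ} (U : Matrix (Fin N) (Fin N) ℝ) (hU : U ∈ Matrix.orthogonalGroup (Fin N) ℝ) :
    (Measure.pi (fun _ : Fin N => gaussianReal 0 1)).map (fun v => U.mulVec v)
      = Measure.pi (fun _ : Fin N => gaussianReal 0 1) := by
  have hcm : Measurable (fun v : Fin N → ℝ => U.mulVec v) :=
    (continuous_const.matrix_mulVec continuous_id).measurable
  let l : EuclideanSpace ℝ (Fin N) →ₗᵢ[ℝ] EuclideanSpace ℝ (Fin N) :=
    ⟨Matrix.toEuclideanLin U, fun x => by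
      rw [EuclideanSpace.norm_eq, EuclideanSpace.norm_eq]
      have := ortho_norm U hU (WithLp.ofLp x)
      simp only [Real.norm_eq_abs, sq_abs]
      exact congrArg Real.sqrt this⟩
  let e := l.toLinearIsometryEquiv rfl
  have h1 := stdGaussian_map e
  rw [← map_pi_eq_stdGaussian, Measure.map_map (by fun_prop) (by fun_prop)] at h1
  have h2 := congrArg (Measure.map (WithLp.ofLp : EuclideanSpace ℝ (Fin N) → _)) h1
  rw [Measure.map_map (by fun_prop) (by fun_prop), Measure.map_map (by fun_prop) (by fun_prop)] at h2
  have h3 : (WithLp.ofLp : EuclideanSpace ℝ (Fin N) → _) ∘ (⇑e ∘ WithLp.toLp 2) = fun v => U.mulVec v := rfl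
  have h4 : (WithLp.ofLp : EuclideanSpace ℝ (Fin N) → (Fin N → ℝ)) ∘ (WithLp.toLp 2) = id := rfl
  rw [h3, h4, Measure.map_id] at h2
  exact h2

lemma meas_mulVec {N : ℕ} : Measurable (fun p : Matrix (Fin N) (Fin N) ℝ × (Fin N → ℝ) => p.1.mulVec p.2) := by
  rw [measurable_pi_iff]
  intro i
  have h : ∀ j, Measurable (fun p : Matrix (Fin N) (Fin N) ℝ × (Fin N → ℝ) => p.1 i j) := fun j =>
    (measurable_pi_apply j).comp ((measurable_pi_apply i).comp measurable_fst)
  have h' : ∀ j, Measurable (fun p : Matrix (Fin N) (Fin N) ℝ × (Fin N → ℝ) => p.2 j) := fun j =>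
    (measurable_pi_apply j).comp measurable_snd
  simp only [Matrix.mulVec, dotProduct]
  exact Finset.measurable_sum _ fun j _ => (h j).mul (h' j)

lemma haar_fixed {N : ℕ} {Ω : Type*} [MeasurableSpace Ω] (μ : Measure Ω) [IsProbabilityMeasure μ]
    (V : Ω → Matrix (Fin N) (Fin N) ℝ) (hV : IsHaarOrthogonal μ V) (A : Set (Fin N → ℝ))
    (hA : MeasurableSet A) (h0 : 0 ∉ A) (hs : ∀ c : ℝ, 0 < c → ∀ v ∈ A, c • v ∈ A) (x : Fin N → ℝ) :
    (μ.map V) {M | M.mulVec x ∈ A} ≤ Measure.pi (fun _ : Fin N => gaussianReal 0 1) A := by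
  obtain ⟨hVm, hVo, -, hVr⟩ := hV
  have : IsProbabilityMeasure (μ.map V) := Measure.isProbabilityMeasure_map hVm.aemeasurable
  have hmr : ∀ y : Fin N → ℝ, Measurable (fun M : Matrix (Fin N) (Fin N) ℝ => M.mulVec y) := fun y =>
    meas_mulVec.comp (measurable_id.prodMk measurable_const)
  have hml : ∀ M : Matrix (Fin N) (Fin N) ℝ, Measurable (fun y : Fin N → ℝ => M.mulVec y) := fun y =>
    meas_mulVec.comp (measurable_const.prodMk measurable_id)
  by_cases hx : x = 0
  · simp [hx, h0]
  have hNe : Nonempty (Fin N) := by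
    by_contra h
    rw [not_nonempty_iff] at h
    exact hx (Subsingleton.elim _ _)
  have pos : ∀ y : Fin N → ℝ, y ≠ 0 → 0 < ∑ n, y n ^ 2 := by
    intro y hy
    obtain ⟨i, hi⟩ := Function.ne_iff.1 hy
    exact Finset.sum_pos' (fun _ _ => sq_nonneg _) ⟨i, Finset.mem_univ _, by
      have : y i ≠ 0 := hi
      positivity⟩
  have key : ∀ y : Fin N → ℝ, y ≠ 0 → (μ.map V) {M | M.mulVec x ∈ A} ≤ (μ.map V) {M | M.mulVec y ∈ A} := by
    intro y hy
    have px := pos x hx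
    have py := pos y hy
    set c := Real.sqrt ((∑ n, y n ^ 2) / (∑ n, x n ^ 2)) with hc
    have hcpos : 0 < c := Real.sqrt_pos.2 (div_pos py px)
    have hc2 : c ^ 2 = (∑ n, y n ^ 2) / (∑ n, x n ^ 2) := Real.sq_sqrt (div_pos py px).le
    obtain ⟨U, hU, hUx⟩ := ortho_transitive y (c • x) (by
      simp only [Pi.smul_apply, smul_eq_mul, mul_pow, ← Finset.mul_sum, hc2]
      field_simp)
    have hVU : Measurable (fun ω => V ω * U) := by
      have : Measurable (fun M : Matrix (Fin N) (Fin N) ℝ => M * U) := by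
        refine measurable_pi_iff.2 fun i => measurable_pi_iff.2 fun j => ?_
        simp only [Matrix.mul_apply]
        exact Finset.measurable_sum _ fun k _ =>
          ((measurable_pi_apply k).comp (measurable_pi_apply i)).mul_const _
      exact this.comp hVm
    have e1 : (μ.map V) {M | M.mulVec x ∈ A} = μ {ω | (V ω).mulVec x ∈ A} :=
      Measure.map_apply hVm (hmr x hA)
    have e2 : (μ.map (fun ω => V ω * U)) {M | M.mulVec y ∈ A} = μ {ω | (V ω * U).mulVec y ∈ A} :=
      Measure.map_apply hVU (hmr y hA)
    rw [e1, ← hVr U hU, e2]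
    refine measure_mono fun ω hω => ?_
    have hω : (V ω).mulVec x ∈ A := hω
    change (V ω * U).mulVec y ∈ A
    rw [← Matrix.mulVec_mulVec, hUx, Matrix.mulVec_smul]
    exact hs c hcpos _ hω
  set γ := Measure.pi (fun _ : Fin N => gaussianReal 0 1) with hγ
  have hna : NullSingletonClass (gaussianReal 0 1) := nullSingletonClass_gaussianReal (by norm_num)
  have hae : ∀ᵐ y ∂γ, y ≠ 0 := by
    have : NullSingletonClass γ := by
      obtain ⟨i⟩ := hNe
      exact Measure.pi_nullSingletonClass i
    rw [ae_iff]; simp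
  have hS : MeasurableSet {p : Matrix (Fin N) (Fin N) ℝ × (Fin N → ℝ) | p.1.mulVec p.2 ∈ A} :=
    meas_mulVec hA
  calc (μ.map V) {M | M.mulVec x ∈ A}
      = ∫⁻ _y, (μ.map V) {M | M.mulVec x ∈ A} ∂γ := by simp
    _ ≤ ∫⁻ y, (μ.map V) {M | M.mulVec y ∈ A} ∂γ := by
        apply lintegral_mono_ae
        filter_upwards [hae] with y hy using key y hy
    _ = ((μ.map V).prod γ) {p : Matrix (Fin N) (Fin N) ℝ × (Fin N → ℝ) | p.1.mulVec p.2 ∈ A} := by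
        rw [Measure.prod_apply_symm hS]; rfl
    _ = ∫⁻ M, γ {y | M.mulVec y ∈ A} ∂(μ.map V) := by
        rw [Measure.prod_apply hS]; rfl
    _ = ∫⁻ ω, γ {y | (V ω).mulVec y ∈ A} ∂μ := by
        exact lintegral_map (measurable_measure_prodMk_left (ν := γ) hS) hVm
    _ = ∫⁻ _ω, γ A ∂μ := by
        congr 1; ext ω
        conv_rhs => rw [hγ, ← gauss_rot (V ω) (hVo ω), Measure.map_apply (hml _) hA]
        rfl
    _ = γ A := by simp

lemma haar_indep {N : ℕ} {Ω : Type*} [MeasurableSpace Ω] (μ : Measure Ω) [IsProbabilityMeasure μ]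
    (V : Ω → Matrix (Fin N) (Fin N) ℝ) (hV : IsHaarOrthogonal μ V) (A : Set (Fin N → ℝ))
    (hA : MeasurableSet A) (h0 : 0 ∉ A) (hs : ∀ c : ℝ, 0 < c → ∀ v ∈ A, c • v ∈ A)
    (x : Ω → (Fin N → ℝ)) (hx : Measurable x) (hi : IndepFun V x μ) :
    μ {ω | (V ω).mulVec (x ω) ∈ A} ≤ Measure.pi (fun _ : Fin N => gaussianReal 0 1) A := by
  have hVm := hV.1
  have : IsProbabilityMeasure (μ.map V) := Measure.isProbabilityMeasure_map hVm.aemeasurable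
  have : IsProbabilityMeasure (μ.map x) := Measure.isProbabilityMeasure_map hx.aemeasurable
  have h1 := (indepFun_iff_map_prod_eq_prod_map_map hVm.aemeasurable hx.aemeasurable).1 hi
  have hS : MeasurableSet {p : Matrix (Fin N) (Fin N) ℝ × (Fin N → ℝ) | p.1.mulVec p.2 ∈ A} :=
    meas_mulVec hA
  calc μ {ω | (V ω).mulVec (x ω) ∈ A}
      = (μ.map (fun ω => (V ω, x ω))) {p : Matrix (Fin N) (Fin N) ℝ × (Fin N → ℝ) | p.1.mulVec p.2 ∈ A} := by
        rw [Measure.map_apply (hVm.prodMk hx) hS]; rfl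
    _ = ∫⁻ y, (μ.map V) {M | M.mulVec y ∈ A} ∂(μ.map x) := by
        rw [h1, Measure.prod_apply_symm hS]; rfl
    _ ≤ ∫⁻ _y, Measure.pi (fun _ : Fin N => gaussianReal 0 1) A ∂(μ.map x) :=
        lintegral_mono fun y => haar_fixed μ V hV A hA h0 hs y
    _ = _ := by simp

lemma chernoff_one (P : Measure ℝ) [IsProbabilityMeasure P] (X : ℝ → ℝ) (hX : Measurable X)
    (h0 : (0:ℝ) ∈ interior (integrableExpSet X P)) (hm : ∫ z, X z ∂P = 0) (ε : ℝ) (hε : 0 < ε) :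
    ∃ q : ℝ, 0 ≤ q ∧ q < 1 ∧ ∀ N : ℕ,
      (Measure.pi (fun _ : Fin N => P)).real {v | ε * N ≤ ∑ n, X (v n)} ≤ q ^ N := by
  have hd : HasDerivAt (fun t => Real.exp (-(t * ε)) * mgf X P t) (-ε) 0 := by
    have h1 := hasDerivAt_mgf h0
    have h2 : HasDerivAt (fun t : ℝ => Real.exp (-(t * ε))) (Real.exp (-(0 * ε)) * (-(1 * ε))) 0 :=
      (((hasDerivAt_id (0:ℝ)).mul_const ε).neg).exp
    have h3 := h2.mul h1
    have h4 : Real.exp (-(0 * ε)) * (-(1 * ε)) * mgf X P 0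
        + Real.exp (-(0 * ε)) * (∫ z, X z * Real.exp (0 * X z) ∂P) = -ε := by simp [hm]
    rw [← h4]
    exact h3
  have hs := (hasDerivAt_iff_tendsto_slope.1 hd).eventually (gt_mem_nhds (show -ε < 0 by linarith))
  have hs' : ∀ᶠ t in 𝓝[>] (0:ℝ), slope (fun t => Real.exp (-(t * ε)) * mgf X P t) 0 t < 0 :=
    hs.filter_mono (nhdsWithin_mono _ (fun t ht => ne_of_gt ht))
  have hi : ∀ᶠ t in 𝓝[>] (0:ℝ), t ∈ integrableExpSet X P :=
    mem_nhdsWithin_of_mem_nhds (mem_interior_iff_mem_nhds.1 h0)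
  obtain ⟨t, ⟨hts, hti⟩, htpos⟩ := ((hs'.and hi).and self_mem_nhdsWithin).exists
  have htpos : 0 < t := htpos
  refine ⟨Real.exp (-(t * ε)) * mgf X P t, mul_nonneg (Real.exp_nonneg _) mgf_nonneg, ?_, ?_⟩
  · rw [slope_def_field] at hts
    simp only [zero_mul, neg_zero, Real.exp_zero, mgf_zero, sub_zero, one_mul,
      div_neg_iff] at hts
    simp at hts
    rcases hts with h | h
    · linarith [h.2]
    · linarith [h.1]
  · intro N
    have hind : iIndepFun (fun (n : Fin N) (v : Fin N → ℝ) => X (v n))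
        (Measure.pi (fun _ : Fin N => P)) := iIndepFun_pi (fun _ => hX.aemeasurable)
    have hmeas : ∀ n : Fin N, Measurable (fun (v : Fin N → ℝ) => X (v n)) := fun n => by fun_prop
    have hmp : ∀ n : Fin N, MeasurePreserving (Function.eval n) (Measure.pi (fun _ : Fin N => P)) P :=
      fun n => measurePreserving_eval _ n
    have hint : ∀ n : Fin N, Integrable (fun v : Fin N → ℝ => Real.exp (t * X (v n)))
        (Measure.pi (fun _ : Fin N => P)) := fun n =>
      (hmp n).integrable_comp_of_integrable (g := fun z => Real.exp (t * X z)) hti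
    have hmg : ∀ n : Fin N, mgf (fun v : Fin N → ℝ => X (v n)) (Measure.pi (fun _ : Fin N => P)) t
        = mgf X P t := fun n => by
      have h5 := integral_map (μ := Measure.pi (fun _ : Fin N => P)) (φ := Function.eval n)
        (f := fun z => Real.exp (t * X z)) (hmp n).measurable.aemeasurable (by fun_prop)
      rw [(hmp n).map_eq] at h5
      exact h5.symm
    have := measure_ge_le_exp_mul_mgf (μ := Measure.pi (fun _ : Fin N => P))
      (X := ∑ n : Fin N, fun (v : Fin N → ℝ) => X (v n)) (ε * N) htpos.le
      (hind.integrable_exp_mul_sum hmeas (fun n _ => hint n))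
    rw [hind.mgf_sum hmeas, Finset.prod_congr rfl (fun n _ => hmg n)] at this
    simp only [Finset.sum_apply, Finset.prod_const, Finset.card_univ, Fintype.card_fin] at this
    refine this.trans (le_of_eq ?_)
    rw [mul_pow, ← Real.exp_nat_mul]
    congr 2
    ring

lemma chernoff_two (P : Measure ℝ) [IsProbabilityMeasure P] (X : ℝ → ℝ) (hX : Measurable X)
    (h0 : (0:ℝ) ∈ interior (integrableExpSet X P)) (hm : ∫ z, X z ∂P = 0) (ε : ℝ) (hε : 0 < ε) :
    ∑' N : ℕ, (Measure.pi (fun _ : Fin N => P)) {v | 0 < N ∧ ε ≤ |(N : ℝ)⁻¹ * ∑ n, X (v n)|} ≠ ∞ := by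
  obtain ⟨q, hq0, hq1, hq⟩ := chernoff_one P X hX h0 hm ε hε
  have h0' : (0:ℝ) ∈ interior (integrableExpSet (fun z => - X z) P) := by
    have : integrableExpSet (fun z => - X z) P = (Homeomorph.neg ℝ) ⁻¹' integrableExpSet X P := by
      ext t; simp [integrableExpSet]
    rw [this, ← Homeomorph.preimage_interior]
    simpa using h0
  obtain ⟨p, hp0, hp1, hp⟩ := chernoff_one P (fun z => - X z) hX.neg h0'
    (by rw [integral_neg, hm, neg_zero]) ε hε
  have hsum : Summable (fun N : ℕ => q ^ N + p ^ N) :=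
    (summable_geometric_of_lt_one hq0 hq1).add (summable_geometric_of_lt_one hp0 hp1)
  have : ∀ N : ℕ, (Measure.pi (fun _ : Fin N => P)) {v | 0 < N ∧ ε ≤ |(N : ℝ)⁻¹ * ∑ n, X (v n)|}
      ≤ ENNReal.ofReal (q ^ N + p ^ N) := by
    intro N
    rw [ENNReal.le_ofReal_iff_toReal_le (measure_ne_top _ _) (by positivity)]
    refine le_trans ?_ (add_le_add (hq N) (hp N))
    refine le_trans (measureReal_mono ?_) (measureReal_union_le _ _)
    rintro v ⟨hN, hv⟩
    have hN' : (0:ℝ) < N := by exact_mod_cast hN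
    rcases le_abs.1 hv with h | h
    · left
      rw [le_inv_mul_iff₀ hN'] at h
      simpa [mul_comm] using h
    · right
      rw [← mul_neg, le_inv_mul_iff₀ hN'] at h
      simpa [mul_comm] using h
  refine ne_top_of_le_ne_top ?_ (ENNReal.tsum_le_tsum this)
  exact hsum.tsum_ofReal_ne_top

lemma gauss_sq_exp : (0:ℝ) ∈ interior (integrableExpSet (fun z : ℝ => z ^ 2 - 1) (gaussianReal 0 1)) := by
  obtain ⟨C, hC, hi⟩ := IsGaussian.exists_integrable_exp_sq (gaussianReal 0 1)
  rw [mem_interior_iff_mem_nhds]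
  filter_upwards [Iio_mem_nhds hC] with t ht
  have h1 : Integrable (fun z : ℝ => Real.exp (-t) * Real.exp (C * ‖z‖ ^ 2)) (gaussianReal 0 1) :=
    hi.const_mul _
  refine h1.mono' (by fun_prop) (ae_of_all _ fun z => ?_)
  rw [Real.norm_of_nonneg (Real.exp_nonneg _), ← Real.exp_add]
  apply Real.exp_le_exp.2
  have : t * z ^ 2 ≤ C * z ^ 2 := mul_le_mul_of_nonneg_right (le_of_lt ht) (sq_nonneg z)
  simp only [Real.norm_eq_abs, sq_abs]
  linarith

lemma gauss_sq_mean : ∫ z, (z ^ 2 - 1) ∂(gaussianReal 0 1) = 0 := by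
  have h := variance_id_gaussianReal (μ := 0) (v := 1)
  rw [variance_eq_integral (by fun_prop)] at h
  simp at h
  have hi : Integrable (fun z : ℝ => z ^ 2) (gaussianReal 0 1) := by
    have := (memLp_id_gaussianReal (μ := 0) (v := 1) 2).integrable_sq
    simpa using this
  rw [integral_sub hi (integrable_const _), h]
  simp

lemma bdd_exp (P : Measure ℝ) [IsProbabilityMeasure P] (X : ℝ → ℝ) (hX : Measurable X) (M : ℝ)
    (hM : ∀ z, |X z| ≤ M) : (0:ℝ) ∈ interior (integrableExpSet X P) := by
  have : integrableExpSet X P = Set.univ := by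
    ext t
    simp only [integrableExpSet, Set.mem_ofPred_eq, Set.mem_univ, iff_true]
    refine Integrable.of_bound (by fun_prop) (Real.exp (|t| * M)) (ae_of_all _ fun z => ?_)
    rw [Real.norm_of_nonneg (Real.exp_nonneg _)]
    apply Real.exp_le_exp.2
    calc t * X z ≤ |t * X z| := le_abs_self _
      _ = |t| * |X z| := abs_mul _ _
      _ ≤ _ := mul_le_mul_of_nonneg_left (hM z) (abs_nonneg t)
  simp [this]

noncomputable def rms {N : ℕ} (v : Fin N → ℝ) : ℝ := Real.sqrt ((1 / (N : ℝ)) * ∑ n : Fin N, v n ^ 2)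

noncomputable def avg {N : ℕ} (f : ℝ → ℝ) (v : Fin N → ℝ) : ℝ := (N : ℝ)⁻¹ * ∑ n : Fin N, f (v n)

lemma rms_nonneg {N : ℕ} (v : Fin N → ℝ) : 0 ≤ rms v := Real.sqrt_nonneg _

lemma rms_sq {N : ℕ} (v : Fin N → ℝ) : rms v ^ 2 = (N : ℝ)⁻¹ * ∑ n : Fin N, v n ^ 2 := by
  unfold rms
  rw [Real.sq_sqrt (by positivity), one_div]

lemma rms_pos {N : ℕ} (v : Fin N → ℝ) (hv : v ≠ 0) : 0 < rms v := by
  obtain ⟨i, hi⟩ := Function.ne_iff.1 hv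
  have hN : 0 < N := i.pos
  have h2 : 0 < ∑ n, v n ^ 2 := Finset.sum_pos' (fun _ _ => sq_nonneg _) ⟨i, Finset.mem_univ _, by
      have : v i ≠ 0 := hi
      positivity⟩
  unfold rms
  positivity

lemma rms_zero {N : ℕ} : rms (0 : Fin N → ℝ) = 0 := by simp [rms]

lemma rms_smul {N : ℕ} (c : ℝ) (hc : 0 < c) (v : Fin N → ℝ) : rms (c • v) = c * rms v := by
  have : rms (c • v) ^ 2 = (c * rms v) ^ 2 := by
    rw [mul_pow, rms_sq, rms_sq]
    simp only [Pi.smul_apply, smul_eq_mul, mul_pow, ← Finset.mul_sum]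
    ring
  exact (pow_left_inj₀ (rms_nonneg _) (mul_nonneg hc.le (rms_nonneg _)) two_ne_zero).1 this

lemma avg_scale {N : ℕ} (f : ℝ → ℝ) (L : ℝ) (hL : 0 ≤ L) (hf : ∀ a b, |f a - f b| ≤ L * |a - b|)
    (a b : ℝ) (v : Fin N → ℝ) : |avg f (a • v) - avg f (b • v)| ≤ L * |a - b| * rms v := by
  have h1 : (N : ℝ)⁻¹ * ∑ n, |v n| ≤ rms v := by
    apply le_of_sq_le_sq _ (rms_nonneg v)
    rw [rms_sq]
    have h := sq_sum_le_card_mul_sum_sq (s := Finset.univ) (f := fun n : Fin N => |v n|)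
    simp only [sq_abs, Finset.card_univ, Fintype.card_fin] at h
    rcases Nat.eq_zero_or_pos N with h0 | h0
    · subst h0; simp
    have hN : (0:ℝ) < N := by exact_mod_cast h0
    rw [mul_pow]
    calc (N:ℝ)⁻¹ ^ 2 * (∑ n, |v n|) ^ 2 ≤ (N:ℝ)⁻¹ ^ 2 * (N * ∑ n, v n ^ 2) := by gcongr
      _ = _ := by field_simp
  calc |avg f (a • v) - avg f (b • v)| = |(N : ℝ)⁻¹ * ∑ n, (f (a * v n) - f (b * v n))| := by
        simp only [avg, Pi.smul_apply, smul_eq_mul, Finset.sum_sub_distrib, mul_sub]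
    _ = (N : ℝ)⁻¹ * |∑ n, (f (a * v n) - f (b * v n))| := by
        rw [abs_mul, abs_of_nonneg (by positivity : (0:ℝ) ≤ (N : ℝ)⁻¹)]
    _ ≤ (N : ℝ)⁻¹ * ∑ n, (L * |a - b| * |v n|) := by
        gcongr
        refine (Finset.abs_sum_le_sum_abs _ _).trans (Finset.sum_le_sum fun n _ => ?_)
        refine (hf _ _).trans (le_of_eq ?_)
        rw [← sub_mul, abs_mul, mul_assoc]
    _ = L * |a - b| * ((N : ℝ)⁻¹ * ∑ n, |v n|) := by
        rw [← Finset.mul_sum]; ring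
    _ ≤ _ := by gcongr

def badSet (N : ℕ) (f : ℝ → ℝ) (r m ε : ℝ) : Set (Fin N → ℝ) :=
  {v | v ≠ 0 ∧ ε ≤ |avg f ((r / rms v) • v) - m|}

lemma badSet_meas (N : ℕ) (f : ℝ → ℝ) (hf : Measurable f) (r m ε : ℝ) :
    MeasurableSet (badSet N f r m ε) := by
  have h1 : Measurable (fun v : Fin N → ℝ => rms v) := by unfold rms; fun_prop
  have h2 : Measurable (fun v : Fin N → ℝ => |avg f ((r / rms v) • v) - m|) := by
    unfold avg
    simp only [Pi.smul_apply, smul_eq_mul]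
    fun_prop
  exact (measurableSet_singleton 0).compl.inter (measurableSet_le measurable_const h2)

lemma badSet_smul (N : ℕ) (f : ℝ → ℝ) (r m ε : ℝ) (c : ℝ) (hc : 0 < c) (v : Fin N → ℝ)
    (hv : v ∈ badSet N f r m ε) : c • v ∈ badSet N f r m ε := by
  refine ⟨smul_ne_zero hc.ne' hv.1, ?_⟩
  have := rms_pos v hv.1
  rw [rms_smul c hc, smul_smul]
  have e : r / (c * rms v) * c = r / rms v := by field_simp
  rw [e]
  exact hv.2

lemma badSet_sum (f : ℝ → ℝ) (hf : Measurable f) (L M : ℝ) (hL : 0 < L)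
    (hfL : ∀ a b, |f a - f b| ≤ L * |a - b|) (hM : ∀ a, |f a| ≤ M) (r ε : ℝ) (hr : 0 < r) (hε : 0 < ε) :
    ∑' N : ℕ, (Measure.pi (fun _ : Fin N => gaussianReal 0 1))
      (badSet N f r (∫ z, f (r * z) ∂(gaussianReal 0 1)) ε) ≠ ∞ := by
  set m := ∫ z, f (r * z) ∂(gaussianReal 0 1) with hm
  have hfi : Integrable (fun z => f (r * z)) (gaussianReal 0 1) :=
    Integrable.of_bound (hf.comp (measurable_const_mul r)).aestronglyMeasurable M (ae_of_all _ fun z => hM _)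
  have s1 := chernoff_two (gaussianReal 0 1) (fun z => z ^ 2 - 1) (by fun_prop) gauss_sq_exp
    gauss_sq_mean (ε / (2 * (L * r))) (by positivity)
  have s2 := chernoff_two (gaussianReal 0 1) (fun z => f (r * z) - m) (by fun_prop)
    (bdd_exp _ _ (by fun_prop) (M + |m|) fun z => (abs_sub _ _).trans (by linarith [hM (r * z)]))
    (by rw [integral_sub hfi (integrable_const _), ← hm]; simp) (ε / 2) (by positivity)
  refine ne_top_of_le_ne_top (ENNReal.add_ne_top.2 ⟨s1, s2⟩) ?_
  rw [← ENNReal.tsum_add]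
  refine ENNReal.tsum_le_tsum fun N => ?_
  refine le_trans (measure_mono ?_) (measure_union_le _ _)
  rintro v ⟨hv0, hv⟩
  obtain ⟨i, -⟩ := Function.ne_iff.1 hv0
  have hN : 0 < N := i.pos
  have hN' : (0:ℝ) < N := by exact_mod_cast hN
  have hpos := rms_pos v hv0
  have e1 : (N : ℝ)⁻¹ * ∑ n, (v n ^ 2 - 1) = rms v ^ 2 - 1 := by
    rw [rms_sq, Finset.sum_sub_distrib]; simp; field_simp
  have e2 : (N : ℝ)⁻¹ * ∑ n, (f (r * v n) - m) = avg f (r • v) - m := by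
    rw [Finset.sum_sub_distrib]; simp [avg]; field_simp
  by_contra hcon
  simp only [Set.mem_union, Set.mem_ofPred_eq, not_or, not_and, not_le] at hcon
  have c1 := hcon.1 hN
  have c2 := hcon.2 hN
  rw [e1] at c1
  rw [e2] at c2
  have h3 := avg_scale f L hL.le hfL (r / rms v) r v
  have h4 : L * |r / rms v - r| * rms v = L * r * |1 - rms v| := by
    have : r / rms v - r = r * (1 - rms v) / rms v := by field_simp
    rw [this, abs_div, abs_mul, abs_of_pos hr, abs_of_pos hpos]
    field_simp
  have h5 : |1 - rms v| ≤ |rms v ^ 2 - 1| := by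
    have : rms v ^ 2 - 1 = (rms v - 1) * (rms v + 1) := by ring
    rw [this, abs_mul, abs_sub_comm]
    exact le_mul_of_one_le_right (abs_nonneg _) ((by linarith : 1 ≤ rms v + 1).trans (le_abs_self _))
  have h6 : L * r * |1 - rms v| < ε / 2 := by
    have := mul_lt_mul_of_pos_left (h5.trans_lt c1) (mul_pos hL hr)
    have e : L * r * (ε / (2 * (L * r))) = ε / 2 := by field_simp
    rw [e] at this
    exact this
  have := abs_sub_le (avg f ((r / rms v) • v)) (avg f (r • v)) m
  linarith

lemma avg_tendsto {Ω : Type*} [MeasurableSpace Ω] (μ : Measure Ω) [IsProbabilityMeasure μ]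
    (x : (N : ℕ) → Ω → (Fin N → ℝ)) (hxmeas : ∀ N, Measurable (x N))
    (O : (N : ℕ) → Ω → Matrix (Fin N) (Fin N) ℝ)
    (hO : ∀ N, IsHaarOrthogonal μ (O N))
    (hindep : ∀ N, IndepFun (O N) (x N) μ)
    (r : ℝ) (hr : 0 < r)
    (h : (N : ℕ) → Ω → (Fin N → ℝ)) (hh : ∀ N ω, h N ω = (O N ω).mulVec (x N ω))
    (hnorm : ∀ᵐ ω ∂μ, Tendsto (fun N : ℕ => rms (h N ω)) atTop (𝓝 r))
    (f : ℝ → ℝ) (hf : Measurable f) (L M : ℝ) (hL : 0 < L)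
    (hfL : ∀ a b, |f a - f b| ≤ L * |a - b|) (hM : ∀ a, |f a| ≤ M) :
    ∀ᵐ ω ∂μ, Tendsto (fun N : ℕ => avg f (h N ω)) atTop
      (𝓝 (∫ z, f (r * z) ∂(gaussianReal 0 1))) := by
  set m := ∫ z, f (r * z) ∂(gaussianReal 0 1) with hm
  have hbc : ∀ k : ℕ, ∀ᵐ ω ∂μ, ∀ᶠ N in atTop, h N ω ∉ badSet N f r m (1 / ((k:ℝ) + 1)) := by
    intro k
    refine ae_eventually_notMem (s := fun N => {ω | h N ω ∈ badSet N f r m (1 / ((k:ℝ) + 1))}) ?_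
    refine ne_top_of_le_ne_top (badSet_sum f hf L M hL hfL hM r (1 / ((k:ℝ) + 1)) hr (by positivity)) ?_
    refine ENNReal.tsum_le_tsum fun N => ?_
    simp only [hh]
    exact haar_indep μ (O N) (hO N) _ (badSet_meas N f hf r m _) (fun h => h.1 rfl)
      (fun c hc v hv => badSet_smul N f r m _ c hc v hv) (x N) (hxmeas N) (hindep N)
  filter_upwards [ae_all_iff.2 hbc, hnorm] with ω h1 h2
  rw [Metric.tendsto_atTop']
  intro ε hε
  obtain ⟨k, hk⟩ := exists_nat_one_div_lt (half_pos hε)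
  have h3 : ∀ᶠ N in atTop, 0 < rms (h N ω) := h2.eventually (lt_mem_nhds hr)
  have h4 : ∀ᶠ N in atTop, |rms (h N ω) - r| < ε / (2 * L) := by
    have := (Metric.tendsto_nhds.1 h2) (ε / (2 * L)) (by positivity)
    simpa [Real.dist_eq] using this
  have h5 : ∀ᶠ N in atTop, dist (avg f (h N ω)) m < ε := by
    filter_upwards [h1 k, h3, h4] with N a1 a3 a4
    have hne : h N ω ≠ 0 := by
      intro h0; rw [h0, rms_zero] at a3; exact lt_irrefl _ a3
    have b1 : |avg f ((r / rms (h N ω)) • h N ω) - m| < 1 / ((k:ℝ) + 1) := by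
      by_contra hc; exact a1 ⟨hne, not_lt.1 hc⟩
    have b2 := avg_scale f L hL.le hfL 1 (r / rms (h N ω)) (h N ω)
    have b3 : L * |1 - r / rms (h N ω)| * rms (h N ω) = L * |rms (h N ω) - r| := by
      have : 1 - r / rms (h N ω) = (rms (h N ω) - r) / rms (h N ω) := by field_simp
      rw [this, abs_div, abs_of_pos a3]
      field_simp
    have b4 : L * |rms (h N ω) - r| < ε / 2 := by
      have := mul_lt_mul_of_pos_left a4 hL
      have e : L * (ε / (2 * L)) = ε / 2 := by field_simp
      rwa [e] at this
    rw [one_smul] at b2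
    rw [Real.dist_eq]
    have := abs_sub_le (avg f (h N ω)) (avg f ((r / rms (h N ω)) • h N ω)) m
    linarith
  obtain ⟨n, hn⟩ := eventually_atTop.1 h5
  exact ⟨n, fun k hk => hn k hk.le⟩

lemma extend_real (v : (N : ℕ) → (Fin N → ℝ)) (r : ℝ) (hr : 0 < r)
    (hv : Tendsto (fun N => rms (v N)) atTop (𝓝 r)) (φ : ℝ → ℝ) (hφc : Continuous φ)
    (hφL : ∀ a b, |φ a - φ b| ≤ |a - b|) (hφM : ∀ a, |φ a| ≤ 1)
    (hq : ∀ q : ℚ, Tendsto (fun N => avg φ ((q : ℝ) • v N)) atTop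
      (𝓝 (∫ z, φ (q * (r * z)) ∂(gaussianReal 0 1)))) (t : ℝ) :
    Tendsto (fun N => avg φ (t • v N)) atTop (𝓝 (∫ z, φ (t * (r * z)) ∂(gaussianReal 0 1))) := by
  have hcont : Continuous (fun t : ℝ => ∫ z, φ (t * (r * z)) ∂(gaussianReal 0 1)) := by
    refine continuous_of_dominated (bound := fun _ => 1) (fun t => ?_) (fun t => ae_of_all _ fun z => ?_)
      (integrable_const _) (ae_of_all _ fun z => ?_)
    · exact (hφc.comp (by fun_prop)).aestronglyMeasurable
    · exact hφM _
    · exact hφc.comp (by fun_prop)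
  rw [Metric.tendsto_nhds]
  intro ε hε
  have h1 : ∀ᶠ s in 𝓝 t, dist (∫ z, φ (s * (r * z)) ∂(gaussianReal 0 1))
      (∫ z, φ (t * (r * z)) ∂(gaussianReal 0 1)) < ε / 3 :=
    (Metric.tendsto_nhds.1 hcont.continuousAt) (ε / 3) (by positivity)
  have h2 : ∀ᶠ s in 𝓝 t, dist s t < ε / (3 * (r + 1)) := Metric.ball_mem_nhds t (by positivity)
  obtain ⟨δ, hδ, hball⟩ := Metric.eventually_nhds_iff.1 (h1.and h2)
  obtain ⟨q, hq1, hq2⟩ := exists_rat_btwn (show t < t + δ by linarith)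
  have hqt := hball (show dist (q:ℝ) t < δ by rw [Real.dist_eq, abs_lt]; constructor <;> linarith)
  filter_upwards [(Metric.tendsto_nhds.1 (hq q)) (ε / 3) (by positivity),
    hv.eventually (gt_mem_nhds (show r < r + 1 by linarith))] with N a1 a2
  have b := avg_scale φ 1 zero_le_one (by simpa using hφL) t q (v N)
  have b2 : 1 * |t - q| * rms (v N) ≤ ε / 3 := by
    have c1 : |t - q| ≤ ε / (3 * (r + 1)) := by
      rw [abs_sub_comm, ← Real.dist_eq]; exact hqt.2.le
    calc 1 * |t - q| * rms (v N) ≤ 1 * (ε / (3 * (r + 1))) * (r + 1) := by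
          gcongr
          exact rms_nonneg _
      _ = ε / 3 := by field_simp
  have t1 := dist_triangle (avg φ (t • v N)) (avg φ ((q:ℝ) • v N)) (∫ z, φ (t * (r * z)) ∂(gaussianReal 0 1))
  have t2 := dist_triangle (avg φ ((q:ℝ) • v N)) (∫ z, φ (q * (r * z)) ∂(gaussianReal 0 1)) (∫ z, φ (t * (r * z)) ∂(gaussianReal 0 1))
  rw [← Real.dist_eq] at b
  linarith [hqt.1]

lemma charFun_split (P : Measure ℝ) [IsFiniteMeasure P] (t : ℝ) :
    charFun P t = ((∫ z, Real.cos (t * z) ∂P : ℝ) : ℂ) + ((∫ z, Real.sin (t * z) ∂P : ℝ) : ℂ) * Complex.I := by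
  have h1 : Integrable (fun z => ((Real.cos (t * z) : ℝ) : ℂ)) P :=
    Integrable.of_bound (by fun_prop) 1 (ae_of_all _ fun z => by
      rw [Complex.norm_real]; exact Real.abs_cos_le_one _)
  have h2 : Integrable (fun z => ((Real.sin (t * z) : ℝ) : ℂ) * Complex.I) P :=
    Integrable.of_bound (by fun_prop) 1 (ae_of_all _ fun z => by
      rw [norm_mul, Complex.norm_I, mul_one, Complex.norm_real]; exact Real.abs_sin_le_one _)
  rw [charFun_apply_real, ← integral_complex_ofReal, ← integral_complex_ofReal, ← integral_mul_const,
    ← integral_add h1 h2]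
  congr 1; ext z
  rw [Complex.exp_mul_I]; push_cast; rfl

lemma integral_empDist {N : ℕ} (v : Fin N → ℝ) (f : ℝ → ℝ) :
    ∫ z, f z ∂(empDist v) = avg f v := by
  unfold empDist avg
  rw [integral_smul_measure, integral_finsetSum_measure (fun i _ => integrable_dirac (by simp))]
  simp

instance empDist_prob {N : ℕ} (v : Fin (N + 1) → ℝ) : IsProbabilityMeasure (empDist v) := by
  constructor
  unfold empDist
  simp
  rw [ENNReal.inv_mul_cancel] <;> simp

lemma map_empDist {N : ℕ} (v : Fin N → ℝ) (g : ℝ → ℝ) (hg : Measurable g) :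
    (empDist v).map g = empDist (fun n => g (v n)) := by
  ext s hs
  rw [Measure.map_apply hg hs]
  simp [empDist, Measure.dirac_apply' _ hs, Measure.dirac_apply' _ (hg hs), Set.indicator]
  rfl

lemma gauss_scale (r : ℝ) (f : ℝ → ℝ) (hf : Continuous f) :
    ∫ z, f z ∂(gaussianReal 0 (Real.toNNReal (r ^ 2))) = ∫ z, f (r * z) ∂(gaussianReal 0 1) := by
  have h := gaussianReal_map_const_mul (μ := 0) (v := 1) r
  have e : (NNReal.mk (r ^ 2) (sq_nonneg r)) = Real.toNNReal (r ^ 2) := by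
    ext; simp [sq_nonneg]
  rw [e, mul_zero, mul_one] at h
  rw [← h, integral_map (by fun_prop) hf.aestronglyMeasurable]

lemma final_step (v : (N : ℕ) → (Fin N → ℝ)) (r : ℝ) (g : ℝ → ℝ) (hg : Measurable g)
    (hNg : gaussianReal 0 (Real.toNNReal (r ^ 2)) {t : ℝ | ¬ ContinuousAt g t} = 0)
    (hc : ∀ t : ℝ, Tendsto (fun N => avg Real.cos (t • v N)) atTop
      (𝓝 (∫ z, Real.cos (t * (r * z)) ∂(gaussianReal 0 1))))
    (hs : ∀ t : ℝ, Tendsto (fun N => avg Real.sin (t • v N)) atTop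
      (𝓝 (∫ z, Real.sin (t * (r * z)) ∂(gaussianReal 0 1)))) (f : ℝ →ᵇ ℝ) :
    Tendsto (fun N : ℕ => ∫ t, f t ∂(empDist (fun n : Fin N => g (v N n)))) atTop
        (𝓝 (∫ t, f t ∂(Measure.map g (gaussianReal 0 (Real.toNNReal (r ^ 2)))))) := by
  set γ := gaussianReal 0 (Real.toNNReal (r ^ 2)) with hγ
  let γP : ProbabilityMeasure ℝ := ⟨γ, inferInstance⟩
  let ν : ℕ → ProbabilityMeasure ℝ := fun N => ⟨empDist (v (N + 1)), inferInstance⟩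
  have hν : Tendsto ν atTop (𝓝 γP) := by
    rw [ProbabilityMeasure.tendsto_iff_tendsto_charFun]
    intro t
    change Tendsto (fun N => charFun (empDist (v (N + 1))) t) atTop (𝓝 (charFun γ t))
    simp_rw [charFun_split, integral_empDist]
    rw [hγ, gauss_scale r (fun z => Real.cos (t * z)) (by fun_prop),
      gauss_scale r (fun z => Real.sin (t * z)) (by fun_prop)]
    have c1 := (tendsto_add_atTop_iff_nat 1).2 (hc t)
    have s1 := (tendsto_add_atTop_iff_nat 1).2 (hs t)
    exact ((Complex.continuous_ofReal.tendsto _).comp c1).add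
      (((Complex.continuous_ofReal.tendsto _).comp s1).mul_const _)
  let γg : ProbabilityMeasure ℝ := ⟨γ.map g, Measure.isProbabilityMeasure_map hg.aemeasurable⟩
  let νg : ℕ → ProbabilityMeasure ℝ := fun N => ⟨empDist (fun n => g (v (N + 1) n)), inferInstance⟩
  have hνg : Tendsto νg atTop (𝓝 γg) := by
    apply tendsto_of_forall_isOpen_le_liminf'
    intro U hU
    have h1 := ProbabilityMeasure.le_liminf_measure_open_of_tendsto hν
      (isOpen_interior (s := g ⁻¹' U))
    change γ.map g U ≤ atTop.liminf (fun N => empDist (fun n => g (v (N + 1) n)) U)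
    have h2 : γ.map g U ≤ γ (interior (g ⁻¹' U)) := by
      rw [Measure.map_apply hg hU.measurableSet]
      apply measure_mono_ae
      have : ∀ᵐ z ∂γ, ContinuousAt g z := by rw [ae_iff]; exact hNg
      filter_upwards [this] with z hz hzU
      exact mem_interior_iff_mem_nhds.2 (hz (hU.mem_nhds hzU))
    refine h2.trans (h1.trans (liminf_le_liminf (Eventually.of_forall fun N => ?_)))
    change empDist (v (N + 1)) _ ≤ _
    rw [← map_empDist _ g hg, Measure.map_apply hg hU.measurableSet]
    exact measure_mono interior_subset
  have := (ProbabilityMeasure.tendsto_iff_forall_integral_tendsto.1 hνg) f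
  exact (tendsto_add_atTop_iff_nat 1).1 this

/-- In the setting of Statement 1 (`h(N) = O(N) x(N)` with
`√((1/N) ∑ₙ x(N)ₙ²) → r > 0` a.s. and `O(N)` Haar orthogonal independent of `x(N)`), if
`g : ℝ → ℝ` is measurable and its set of discontinuity points is null for `N(0, r²)`, then
the empirical distribution of the entries of `g(h(N))` (with `g` applied entrywise) converges
weakly to the law of `g(Z)`, `Z ∼ N(0, r²)`, almost surely. -/
theorem stmt4 {Ω : Type*} [MeasurableSpace Ω] (μ : Measure Ω) [IsProbabilityMeasure μ]
    (x : (N : ℕ) → Ω → (Fin N → ℝ)) (hxmeas : ∀ N, Measurable (x N))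
    (O : (N : ℕ) → Ω → Matrix (Fin N) (Fin N) ℝ)
    (hO : ∀ N, IsHaarOrthogonal μ (O N))
    (hindep : ∀ N, IndepFun (O N) (x N) μ)
    (r : ℝ) (hr : 0 < r)
    (hnorm : ∀ᵐ ω ∂μ,
      Tendsto (fun N : ℕ => Real.sqrt ((1 / (N : ℝ)) * ∑ n : Fin N, (x N ω n) ^ 2))
        atTop (𝓝 r))
    (h : (N : ℕ) → Ω → (Fin N → ℝ)) (hh : ∀ N ω, h N ω = (O N ω).mulVec (x N ω))
    (g : ℝ → ℝ) (hg : Measurable g)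
    -- the discontinuity set of `g` is null for `N(0, r²)`, i.e. `P(Z ∈ N_g) = 0`
    (hNg : gaussianReal 0 (Real.toNNReal (r ^ 2)) {t : ℝ | ¬ ContinuousAt g t} = 0) :
    ∀ᵐ ω ∂μ, ∀ f : ℝ →ᵇ ℝ,
      Tendsto (fun N : ℕ => ∫ t, f t ∂(empDist (fun n : Fin N => g (h N ω n)))) atTop
        (𝓝 (∫ t, f t ∂(Measure.map g (gaussianReal 0 (Real.toNNReal (r ^ 2)))))) := by
  have hn : ∀ᵐ ω ∂μ, Tendsto (fun N : ℕ => rms (h N ω)) atTop (𝓝 r) := by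
    filter_upwards [hnorm] with ω hω
    refine hω.congr fun N => ?_
    unfold rms
    rw [hh, ortho_norm _ ((hO N).2.1 ω)]
  have key : ∀ φ : ℝ → ℝ, Continuous φ → (∀ a b, |φ a - φ b| ≤ |a - b|) → (∀ a, |φ a| ≤ 1) →
      ∀ᵐ ω ∂μ, ∀ t : ℝ, Tendsto (fun N => avg φ (t • h N ω)) atTop
        (𝓝 (∫ z, φ (t * (r * z)) ∂(gaussianReal 0 1))) := by
    intro φ hφ hL hM
    have hq : ∀ q : ℚ, ∀ᵐ ω ∂μ, Tendsto (fun N => avg φ ((q : ℝ) • h N ω)) atTop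
        (𝓝 (∫ z, φ (q * (r * z)) ∂(gaussianReal 0 1))) := by
      intro q
      exact avg_tendsto μ x hxmeas O hO hindep r hr h hh hn (fun z => φ (q * z))
        (hφ.comp (by fun_prop)).measurable (|(q : ℝ)| + 1) 1 (by positivity)
        (fun a b => (hL _ _).trans (by
          rw [← mul_sub, abs_mul]
          gcongr
          linarith)) (fun a => hM _)
    filter_upwards [ae_all_iff.2 hq, hn] with ω h1 h2 t
    exact extend_real (fun N => h N ω) r hr h2 φ hφ hL hM h1 t
  filter_upwards [key Real.cos Real.continuous_cos Real.abs_cos_sub_cos_le Real.abs_cos_le_one,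
    key Real.sin Real.continuous_sin Real.abs_sin_sub_sin_le Real.abs_sin_le_one] with ω h1 h2 f
  exact final_step (fun N => h N ω) r g hg hNg h1 h2 f
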